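/- arXiv:2211.11243 — 6 statements merged into one kernel-verified Lean document; each statement's English description precedes it below -/
import Mathlib

section
/- Let I be a real-valued function on finite subsets of a type α that is superadditive on disjoint sets, i.e. I(S₁ ∪ S₂) ≥ I(S₁) + I(S₂) whenever S₁ and S₂ are disjoint finite sets. Let Φ₁, …, Φ_N be finite subsets of α and let Φ_g = ⋂_{i=1}^N Φ_i. Suppose there is a set J ⊆ {1,…,N} of cardinality K and a constant δ > 0 such that for every j ∈ J there is a finite set Z_j ⊆ Φ_j with Z_j ∩ Φ_g = ∅ and max_{z ⊆ Z_j} I(z) ≥ δ. Then (1/N) ∑_{i=1}^N max_{S ⊆ Φ_i} I(S) ≥ max_{S ⊆ Φ_g} I(S) + (K/N)·δ, where all maxima are taken over all (finite) subsets of the indicated set. -/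
/-- A superadditive set function has superadditive maxima over subsets: disjoint sets `A`, `B`
inside `C` contribute additively to the maximum over subsets of `C`. -/
theorem sup'_powerset_add_le_of_disjoint {α : Type*} [DecidableEq α] {I : Finset α → ℝ}
    (hsuper : ∀ S₁ S₂ : Finset α, Disjoint S₁ S₂ → I S₁ + I S₂ ≤ I (S₁ ∪ S₂))
    {A B C : Finset α} (hAB : Disjoint A B) (hA : A ⊆ C) (hB : B ⊆ C) :
    A.powerset.sup' A.powerset_nonempty I + B.powerset.sup' B.powerset_nonempty I ≤
      C.powerset.sup' C.powerset_nonempty I := by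
  obtain ⟨S, hS, hSmax⟩ := Finset.exists_mem_eq_sup' A.powerset_nonempty I
  obtain ⟨T, hT, hTmax⟩ := Finset.exists_mem_eq_sup' B.powerset_nonempty I
  rw [Finset.mem_powerset] at hS hT
  rw [hSmax, hTmax]
  exact (hsuper S T (hAB.mono hS hT)).trans <| Finset.le_sup' I <|
    Finset.mem_powerset.2 (Finset.union_subset (hS.trans hA) (hT.trans hB))

/-- core of Theorem 1 of the paper. If `I` is superadditive on
disjoint finite sets, `Φ g` is the intersection of the `Φ i`, and `K` of the clients
possess an informative extra invariant set `Z j ⊆ Φ j` disjoint from `Φg` with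
`max_{z ⊆ Z j} I z ≥ δ`, then the average of the maxima over subsets of the `Φ i`
exceeds the maximum over subsets of `Φg` by at least `(K/N)·δ`. -/
theorem stmt0 {α : Type*} [DecidableEq α] (I : Finset α → ℝ)
    (hsuper : ∀ S₁ S₂ : Finset α, Disjoint S₁ S₂ → I S₁ + I S₂ ≤ I (S₁ ∪ S₂))
    (N : ℕ) (hN : 0 < N) (Φ : Fin N → Finset α) (Φg : Finset α)
    (hΦg : ∀ x : α, x ∈ Φg ↔ ∀ i : Fin N, x ∈ Φ i)
    (J : Finset (Fin N)) (K : ℕ) (hK : J.card = K)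
    (δ : ℝ) (hδ : 0 < δ) (Z : Fin N → Finset α)
    (hZsub : ∀ j ∈ J, Z j ⊆ Φ j)
    (hZdisj : ∀ j ∈ J, Z j ∩ Φg = ∅)
    (hZinf : ∀ j ∈ J, δ ≤ (Z j).powerset.sup' (Z j).powerset_nonempty I) :
    Φg.powerset.sup' Φg.powerset_nonempty I + ((K : ℝ) / N) * δ ≤
      (1 / (N : ℝ)) * ∑ i : Fin N, (Φ i).powerset.sup' (Φ i).powerset_nonempty I := by
  have hN' : (0 : ℝ) < N := by exact_mod_cast hN
  have hsub (i : Fin N) : Φg ⊆ Φ i := fun x hx => (hΦg x).1 hx i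
  have hbound (i : Fin N) :
      Φg.powerset.sup' Φg.powerset_nonempty I + (if i ∈ J then δ else 0) ≤
        (Φ i).powerset.sup' (Φ i).powerset_nonempty I := by
    split_ifs with hi
    · exact (add_le_add_right (hZinf i hi) _).trans <|
        sup'_powerset_add_le_of_disjoint hsuper
          (Finset.disjoint_iff_inter_eq_empty.2 (hZdisj i hi)).symm (hsub i) (hZsub i hi)
    · rw [add_zero]
      exact Finset.sup'_mono I (Finset.powerset_mono.2 (hsub i)) Φg.powerset_nonempty
  have hsum := Finset.sum_le_sum fun i (_ : i ∈ Finset.univ) => hbound i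
  rw [Finset.sum_add_distrib, Finset.sum_ite_mem, Finset.univ_inter] at hsum
  simp only [Finset.sum_const, Finset.card_univ, Fintype.card_fin, nsmul_eq_mul, hK] at hsum
  rw [one_div, inv_mul_eq_div, le_div_iff₀ hN']
  refine le_of_eq_of_le ?_ hsum
  field_simp
end

section
/- Let R ≥ 1 be an integer, let L ≥ 0, let γ ≥ 0 satisfy γ² ≤ 1/(2R²L²) (interpreted as no constraint if L = 0), let G ≥ 0, and let (x_r)_{r≥0} be a sequence of nonnegative reals with x_0 = 0 and x_{r+1} ≤ (1 + 1/R)(1 + 1/(2R) + Rγ²L²)·x_r + (1 + 1/R)(1 + 2R)·γ²·G for all r ≥ 0. Then for every r ≥ 0: x_r ≤ R(R+1)·((1 + 1/R)^{2r} − 1)·γ²·G. -/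
/-- the scalar drift recursion lemma used in the proof of Theorem 2.
Here the step-size condition `γ² ≤ 1/(2R²L²)` is written multiplicatively as
`γ² · (2R²L²) ≤ 1`, which imposes no constraint when `L = 0`. -/
theorem stmt2 (R : ℕ) (hR : 1 ≤ R) (L γ G : ℝ)
    (hL : 0 ≤ L) (hγ : 0 ≤ γ) (hG : 0 ≤ G)
    (hstep : γ ^ 2 * (2 * (R : ℝ) ^ 2 * L ^ 2) ≤ 1)
    (x : ℕ → ℝ) (hx0 : x 0 = 0) (hxnn : ∀ r, 0 ≤ x r)
    (hrec : ∀ r : ℕ,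
      x (r + 1) ≤ (1 + 1 / (R : ℝ)) * (1 + 1 / (2 * (R : ℝ)) + (R : ℝ) * γ ^ 2 * L ^ 2) * x r
        + (1 + 1 / (R : ℝ)) * (1 + 2 * (R : ℝ)) * γ ^ 2 * G) :
    ∀ r : ℕ, x r ≤ (R : ℝ) * ((R : ℝ) + 1) * ((1 + 1 / (R : ℝ)) ^ (2 * r) - 1) * γ ^ 2 * G := by
  have hRpos : (0 : ℝ) < R := by exact_mod_cast hR
  have hdrift : (R : ℝ) * γ ^ 2 * L ^ 2 ≤ 1 / (2 * (R : ℝ)) := by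
    rw [le_div_iff₀ (by positivity)]
    linarith
  have hfactor : (1 + 1 / (R : ℝ)) * (1 + 1 / (2 * (R : ℝ)) + (R : ℝ) * γ ^ 2 * L ^ 2)
      ≤ (1 + 1 / (R : ℝ)) ^ 2 := by
    rw [sq (1 + 1 / (R : ℝ))]
    refine mul_le_mul_of_nonneg_left ?_ (by positivity)
    have : 1 / (2 * (R : ℝ)) + 1 / (2 * (R : ℝ)) = 1 / (R : ℝ) := by
      field_simp
      norm_num
    linarith
  intro r
  induction r with
  | zero => simp [hx0]
  | succ r ih =>
    calc x (r + 1)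
        ≤ (1 + 1 / (R : ℝ)) * (1 + 1 / (2 * (R : ℝ)) + (R : ℝ) * γ ^ 2 * L ^ 2) * x r
          + (1 + 1 / (R : ℝ)) * (1 + 2 * (R : ℝ)) * γ ^ 2 * G := hrec r
      _ ≤ (1 + 1 / (R : ℝ)) ^ 2 * x r
          + (1 + 1 / (R : ℝ)) * (1 + 2 * (R : ℝ)) * γ ^ 2 * G := by
        gcongr
        exact hxnn r
      _ ≤ (1 + 1 / (R : ℝ)) ^ 2
            * ((R : ℝ) * ((R : ℝ) + 1) * ((1 + 1 / (R : ℝ)) ^ (2 * r) - 1) * γ ^ 2 * G)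
          + (1 + 1 / (R : ℝ)) * (1 + 2 * (R : ℝ)) * γ ^ 2 * G := by
        gcongr
      _ = (R : ℝ) * ((R : ℝ) + 1) * ((1 + 1 / (R : ℝ)) ^ (2 * (r + 1)) - 1) * γ ^ 2 * G := by
        rw [mul_add 2 r 1, pow_add, mul_one]
        generalize (1 + 1 / (R : ℝ)) ^ (2 * r) = p
        field_simp
        ring
end

section
/- Let E be a real inner product space and f : E → ℝ a differentiable function whose gradient ∇f is L-Lipschitz with L > 0. Let R ≥ 1 be an integer and let γ > 0 satisfy γ ≤ 1/(√2·R·L). Define iterates x_0 = x and x_{r+1} = x_r − γ∇f(x_r) for r ≥ 0. Then for every r ≥ 0: ‖x_r − x‖² ≤ R(R+1)·((1 + 1/R)^{2r} − 1)·γ²·‖∇f(x)‖². -/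
/-- `g` is the gradient of `f : E → ℝ` at `x`: the Fréchet derivative of `f` at `x`
is `y ↦ ⟪g, y⟫`. (Stated via `innerSL` so that no completeness of `E` is needed.) -/
def HasGradAt {E : Type*} [NormedAddCommGroup E] [InnerProductSpace ℝ E]
    (f : E → ℝ) (g x : E) : Prop :=
  HasFDerivAt f (innerSL ℝ g) x

/-- One step of the drift recursion: if `e ≤ d + s` with `s ≤ u * d + G` and
`2 * u ^ 2 ≤ (1 / R) ^ 2`,
then Young's inequality bounds `e ^ 2` by an affine function of `d ^ 2`. -/
lemma sq_le_of_le_add_of_le_mul_add {R d e s u G : ℝ} (hR : 0 < R) (he0 : 0 ≤ e)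
    (hs0 : 0 ≤ s) (he : e ≤ d + s) (hs : s ≤ u * d + G) (hu : 2 * u ^ 2 ≤ (1 / R) ^ 2) :
    e ^ 2 ≤ (1 + 1 / R) ^ 2 * d ^ 2 + 2 * (R + 1) * G ^ 2 := by
  have young : (d + s) ^ 2 ≤ (1 + 1 / R) * d ^ 2 + (1 + R) * s ^ 2 := by
    have h : 0 ≤ R * (1 / R * d - s) ^ 2 := by positivity
    have h' : R * (1 / R * d - s) ^ 2 = 1 / R * d ^ 2 - 2 * d * s + R * s ^ 2 := by
      field_simp
      ring
    linarith
  have hs2 : s ^ 2 ≤ (1 / R) ^ 2 * d ^ 2 + 2 * G ^ 2 := by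
    have h1 : s ^ 2 ≤ (u * d + G) ^ 2 := pow_le_pow_left₀ hs0 hs 2
    have h2 := mul_le_mul_of_nonneg_right hu (sq_nonneg d)
    nlinarith [sq_nonneg (u * d - G)]
  calc e ^ 2 ≤ (d + s) ^ 2 := pow_le_pow_left₀ he0 he 2
    _ ≤ (1 + 1 / R) * d ^ 2 + (1 + R) * s ^ 2 := young
    _ ≤ (1 + 1 / R) * d ^ 2 + (1 + R) * ((1 / R) ^ 2 * d ^ 2 + 2 * G ^ 2) := by gcongr
    _ = (1 + 1 / R) ^ 2 * d ^ 2 + 2 * (R + 1) * G ^ 2 := by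
      field_simp
      ring

/-- drift bound for local gradient-descent iterates
`x_{r+1} = x_r − γ ∇f(x_r)` of an `L`-smooth function, with step size
`γ ≤ 1/(√2·R·L)`. -/
theorem stmt3 {E : Type*} [NormedAddCommGroup E] [InnerProductSpace ℝ E]
    (f : E → ℝ) (g : E → E) (hf : ∀ x, HasGradAt f (g x) x)
    (L : ℝ) (hL : 0 < L)
    (hLip : ∀ x y, ‖g x - g y‖ ≤ L * ‖x - y‖)
    (R : ℕ) (hR : 1 ≤ R) (γ : ℝ) (hγ : 0 < γ)
    (hγle : γ ≤ 1 / (Real.sqrt 2 * (R : ℝ) * L))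
    (x0 : E) (xs : ℕ → E) (hxs0 : xs 0 = x0)
    (hstep : ∀ r : ℕ, xs (r + 1) = xs r - γ • g (xs r)) :
    ∀ r : ℕ, ‖xs r - x0‖ ^ 2 ≤
      (R : ℝ) * ((R : ℝ) + 1) * ((1 + 1 / (R : ℝ)) ^ (2 * r) - 1) * γ ^ 2 * ‖g x0‖ ^ 2 := by
  have hRpos : (0 : ℝ) < R := by exact_mod_cast hR
  have hu : 2 * (γ * L) ^ 2 ≤ (1 / (R : ℝ)) ^ 2 := by
    have h1 : √2 * (γ * L) ≤ 1 / (R : ℝ) := by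
      rw [le_div_iff₀ (by positivity)] at hγle ⊢
      linarith
    calc 2 * (γ * L) ^ 2 = (√2 * (γ * L)) ^ 2 := by
          rw [mul_pow √2, Real.sq_sqrt zero_le_two]
      _ ≤ (1 / (R : ℝ)) ^ 2 := pow_le_pow_left₀ (by positivity) h1 2
  intro r
  induction r with
  | zero => simp [hxs0]
  | succ r ih =>
    have he : ‖xs (r + 1) - x0‖ ≤ ‖xs r - x0‖ + γ * ‖g (xs r)‖ := by
      rw [hstep, sub_right_comm]
      refine (norm_sub_le _ _).trans_eq ?_
      rw [norm_smul, Real.norm_of_nonneg hγ.le]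
    have hs : γ * ‖g (xs r)‖ ≤ γ * L * ‖xs r - x0‖ + γ * ‖g x0‖ := by
      rw [mul_assoc, ← mul_add]
      gcongr
      have h1 := norm_sub_norm_le (g (xs r)) (g x0)
      linarith [hLip (xs r) x0]
    have hcoef : 2 * ((R : ℝ) + 1) ≤ R * (R + 1) * ((1 + 1 / (R : ℝ)) ^ 2 - 1) := by
      have h : (R : ℝ) * (R + 1) * ((1 + 1 / (R : ℝ)) ^ 2 - 1)
          = 2 * ((R : ℝ) + 1) + (R + 1) / R := by
        field_simp
        ring
      rw [h]
      exact le_add_of_nonneg_right (by positivity)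
    calc ‖xs (r + 1) - x0‖ ^ 2
        ≤ (1 + 1 / (R : ℝ)) ^ 2 * ‖xs r - x0‖ ^ 2 + 2 * (R + 1) * (γ * ‖g x0‖) ^ 2 :=
          sq_le_of_le_add_of_le_mul_add hRpos (norm_nonneg _) (by positivity) he hs hu
      _ ≤ (1 + 1 / (R : ℝ)) ^ 2 * (R * (R + 1) * ((1 + 1 / (R : ℝ)) ^ (2 * r) - 1) * γ ^ 2 *
            ‖g x0‖ ^ 2) + R * (R + 1) * ((1 + 1 / (R : ℝ)) ^ 2 - 1) * (γ * ‖g x0‖) ^ 2 := by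
          gcongr
      _ = R * (R + 1) * ((1 + 1 / (R : ℝ)) ^ (2 * (r + 1)) - 1) * γ ^ 2 * ‖g x0‖ ^ 2 := by
          ring
end

section
/- Let E be a real inner product space, N ≥ 1, and let L_1, …, L_N : E → ℝ be differentiable functions, each with L_F-Lipschitz gradient (L_F > 0). Let L = (1/N)∑_{i=1}^N L_i and suppose the bounded-variance condition holds with constant δ_L: (1/N)∑_{i=1}^N ‖∇L_i(ν) − ∇L(ν)‖² ≤ δ_L² for every ν ∈ E. Let R ≥ 1 be an integer and γ > 0 with γ ≤ 1/(√2·R·L_F). Fix ν_t ∈ E and define, for each i, the local iterates ν_{i,0}^t = ν_t and ν_{i,r+1}^t = ν_{i,r}^t − γ∇L_i(ν_{i,r}^t). Then (1/(NR)) ∑_{i=1}^N ∑_{r=0}^{R−1} ‖∇L_i(ν_{i,r}^t) − ∇L_i(ν_t)‖² ≤ 16R²γ²L_F²·δ_L² + 16R²γ²L_F²·‖∇L(ν_t)‖². -/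
/-- The global objective `L = (1/N) ∑ᵢ Lᵢ`. -/
noncomputable def avgFn {E : Type*} (N : ℕ) (Li : Fin N → E → ℝ) : E → ℝ :=
  fun ν => (N : ℝ)⁻¹ * ∑ i, Li i ν

/-- Drift of gradient descent with an `LF`-Lipschitz gradient from its starting point. -/
theorem norm_gradientDescent_sub_le {E : Type*} [NormedAddCommGroup E] [InnerProductSpace ℝ E]
    {g : E → E} {LF γ : ℝ} (hLF : 0 < LF) (hγ : 0 < γ)
    (hLip : ∀ x y, ‖g x - g y‖ ≤ LF * ‖x - y‖) {x : ℕ → E}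
    (hstep : ∀ r, x (r + 1) = x r - γ • g (x r)) (r : ℕ) :
    LF * ‖x r - x 0‖ ≤ (Real.exp (r * (γ * LF)) - 1) * ‖g (x 0)‖ := by
  induction r with
  | zero => simp
  | succ r ih =>
    have hg : ‖g (x r)‖ ≤ LF * ‖x r - x 0‖ + ‖g (x 0)‖ := by
      linarith [hLip (x r) (x 0), norm_sub_norm_le (g (x r)) (g (x 0))]
    have hx : ‖x (r + 1) - x 0‖ ≤ ‖x r - x 0‖ + γ * ‖g (x r)‖ := by
      have h : x (r + 1) - x 0 = (x r - x 0) - γ • g (x r) := by rw [hstep]; abel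
      rw [h]
      refine (norm_sub_le _ _).trans ?_
      rw [norm_smul, Real.norm_of_nonneg hγ.le]
    have hexp : Real.exp (r * (γ * LF)) * (1 + γ * LF)
        ≤ Real.exp ((r + 1 : ℕ) * (γ * LF)) := by
      push_cast
      rw [add_mul, one_mul, Real.exp_add]
      gcongr
      linarith [Real.add_one_le_exp (γ * LF)]
    calc LF * ‖x (r + 1) - x 0‖
        ≤ LF * (‖x r - x 0‖ + γ * (LF * ‖x r - x 0‖ + ‖g (x 0)‖)) := by
          gcongr
          exact hx.trans (by gcongr)
      _ = (1 + γ * LF) * (LF * ‖x r - x 0‖) + γ * LF * ‖g (x 0)‖ := by ring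
      _ ≤ (1 + γ * LF) * ((Real.exp (r * (γ * LF)) - 1) * ‖g (x 0)‖)
            + γ * LF * ‖g (x 0)‖ := by gcongr
      _ = (Real.exp (r * (γ * LF)) * (1 + γ * LF) - 1) * ‖g (x 0)‖ := by ring
      _ ≤ _ := by gcongr

/-- The gradient along gradient descent stays close to the initial gradient as long as the
total step length is at most `1 / LF`. -/
theorem norm_gradient_gradientDescent_sub_le {E : Type*} [NormedAddCommGroup E]
    [InnerProductSpace ℝ E] {g : E → E} {LF γ : ℝ} (hLF : 0 < LF) (hγ : 0 < γ)
    (hLip : ∀ x y, ‖g x - g y‖ ≤ LF * ‖x - y‖) {x : ℕ → E}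
    (hstep : ∀ r, x (r + 1) = x r - γ • g (x r)) {r : ℕ} (hr : r * (γ * LF) ≤ 1) :
    ‖g (x r) - g (x 0)‖ ≤ 2 * (r * (γ * LF)) * ‖g (x 0)‖ := by
  have h0 : 0 ≤ r * (γ * LF) := by positivity
  have hexp := (abs_le.1 (Real.abs_exp_sub_one_sub_id_le (abs_le.2 ⟨by linarith, hr⟩))).2
  refine ((hLip _ _).trans (norm_gradientDescent_sub_le hLF hγ hLip hstep r)).trans ?_
  gcongr
  nlinarith

/-- aggregated gradient-drift bound for the local iterates of the
federated algorithm, under `L_F`-smoothness of each local objective and the bounded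
variance condition. -/
theorem stmt5 {E : Type*} [NormedAddCommGroup E] [InnerProductSpace ℝ E]
    (N : ℕ) (hN : 1 ≤ N) (Li : Fin N → E → ℝ) (gi : Fin N → E → E)
    (hgrad : ∀ i x, HasGradAt (Li i) (gi i x) x)
    (LF : ℝ) (hLF : 0 < LF)
    (hLip : ∀ i x y, ‖gi i x - gi i y‖ ≤ LF * ‖x - y‖)
    (gL : E → E) (hgL : ∀ x, HasGradAt (avgFn N Li) (gL x) x)
    (δL : ℝ)
    (hvar : ∀ ν : E, (N : ℝ)⁻¹ * ∑ i, ‖gi i ν - gL ν‖ ^ 2 ≤ δL ^ 2)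
    (R : ℕ) (hR : 1 ≤ R) (γ : ℝ) (hγ : 0 < γ)
    (hγle : γ ≤ 1 / (Real.sqrt 2 * (R : ℝ) * LF))
    (νt : E) (νloc : Fin N → ℕ → E)
    (hν0 : ∀ i, νloc i 0 = νt)
    (hνstep : ∀ i r, νloc i (r + 1) = νloc i r - γ • gi i (νloc i r)) :
    (1 / ((N : ℝ) * (R : ℝ))) * ∑ i, ∑ r ∈ Finset.range R, ‖gi i (νloc i r) - gi i νt‖ ^ 2 ≤
      16 * (R : ℝ) ^ 2 * γ ^ 2 * LF ^ 2 * δL ^ 2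
        + 16 * (R : ℝ) ^ 2 * γ ^ 2 * LF ^ 2 * ‖gL νt‖ ^ 2 := by
  have hN0 : (0 : ℝ) < N := by exact_mod_cast hN
  have hR0 : (0 : ℝ) < R := by exact_mod_cast hR
  have hRq : R * (γ * LF) ≤ 1 := by
    have hs : 1 ≤ Real.sqrt 2 := Real.one_le_sqrt.2 one_le_two
    rw [le_div_iff₀ (by positivity)] at hγle
    have : R * (γ * LF) * 1 ≤ R * (γ * LF) * Real.sqrt 2 := by gcongr
    linarith
  have hterm : ∀ i, ∀ r ∈ Finset.range R, ‖gi i (νloc i r) - gi i νt‖ ^ 2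
      ≤ 4 * (R * (γ * LF)) ^ 2 * ‖gi i νt‖ ^ 2 := by
    intro i r hr
    have hrR : r * (γ * LF) ≤ R * (γ * LF) := by
      gcongr
      exact (Finset.mem_range.1 hr).le
    have h := norm_gradient_gradientDescent_sub_le hLF hγ (hLip i) (hνstep i) (hrR.trans hRq)
    rw [hν0] at h
    calc ‖gi i (νloc i r) - gi i νt‖ ^ 2 ≤ (2 * (R * (γ * LF)) * ‖gi i νt‖) ^ 2 := by
          gcongr
          exact h.trans (by gcongr)
      _ = _ := by ring
  have hnorm : ∀ i, ‖gi i νt‖ ^ 2 ≤ 2 * ‖gi i νt - gL νt‖ ^ 2 + 2 * ‖gL νt‖ ^ 2 := by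
    intro i
    have h : ‖gi i νt‖ ≤ ‖gi i νt - gL νt‖ + ‖gL νt‖ := by
      simpa using norm_add_le (gi i νt - gL νt) (gL νt)
    nlinarith [norm_nonneg (gi i νt), sq_nonneg (‖gi i νt - gL νt‖ - ‖gL νt‖)]
  have hmean : (N : ℝ)⁻¹ * ∑ i, ‖gi i νt‖ ^ 2 ≤ 2 * δL ^ 2 + 2 * ‖gL νt‖ ^ 2 := by
    calc (N : ℝ)⁻¹ * ∑ i, ‖gi i νt‖ ^ 2
        ≤ (N : ℝ)⁻¹ * ∑ i, (2 * ‖gi i νt - gL νt‖ ^ 2 + 2 * ‖gL νt‖ ^ 2) := by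
          gcongr with i
          exact hnorm i
      _ = 2 * ((N : ℝ)⁻¹ * ∑ i, ‖gi i νt - gL νt‖ ^ 2) + 2 * ‖gL νt‖ ^ 2 := by
          rw [Finset.sum_add_distrib, ← Finset.mul_sum, Finset.sum_const, Finset.card_univ,
            Fintype.card_fin, nsmul_eq_mul]
          field_simp
      _ ≤ _ := by
          gcongr
          exact hvar νt
  calc (1 / ((N : ℝ) * (R : ℝ))) * ∑ i, ∑ r ∈ Finset.range R, ‖gi i (νloc i r) - gi i νt‖ ^ 2
      ≤ (1 / ((N : ℝ) * (R : ℝ))) *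
          ∑ i, ∑ _r ∈ Finset.range R, 4 * (R * (γ * LF)) ^ 2 * ‖gi i νt‖ ^ 2 := by
        gcongr with i _ r hr
        exact hterm i r hr
    _ = 4 * (R * (γ * LF)) ^ 2 * ((N : ℝ)⁻¹ * ∑ i, ‖gi i νt‖ ^ 2) := by
        simp only [Finset.sum_const, Finset.card_range, nsmul_eq_mul, ← Finset.mul_sum]
        field_simp
    _ ≤ 4 * (R * (γ * LF)) ^ 2 * (4 * δL ^ 2 + 4 * ‖gL νt‖ ^ 2) := by
        gcongr
        linarith [sq_nonneg δL, sq_nonneg ‖gL νt‖]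
    _ = _ := by ring
end

section
/- Let E be a real inner product space, N ≥ 1, and let L_1, …, L_N : E → ℝ be differentiable functions whose average L = (1/N)∑_{i=1}^N L_i is differentiable with L_F-Lipschitz gradient (L_F > 0). Let R ≥ 1 be an integer, γ > 0, α > 0, and set γ̂ = αγR. Fix ν_t ∈ E, define for each i the local iterates ν_{i,0}^t = ν_t and ν_{i,r+1}^t = ν_{i,r}^t − γ∇L_i(ν_{i,r}^t) for r = 0,…,R−1, and the server update ν_{t+1} = ν_t − α(ν_t − (1/N)∑_{i=1}^N ν_{i,R}^t). Then L(ν_{t+1}) − L(ν_t) ≤ −(γ̂/2)·(1 − (R+1)γ̂L_F/R)·‖∇L(ν_t)‖² + (γ̂/2)·(1 + (1+R)γ̂L_F)·(1/(NR)) ∑_{i=1}^N ∑_{r=0}^{R−1} ‖∇L_i(ν_{i,r}^t) − ∇L_i(ν_t)‖². -/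
theorem HasGradAt.unique {E : Type*} [NormedAddCommGroup E] [InnerProductSpace ℝ E]
    {f : E → ℝ} {g g' x : E} (h : HasGradAt f g x) (h' : HasGradAt f g' x) : g = g' := by
  have h_eq : innerSL ℝ g = innerSL ℝ g' := HasFDerivAt.unique h h'
  refine ext_inner_right ℝ fun v => ?_
  simpa using congrArg (fun φ => φ v) h_eq

theorem hasGradAt_avgFn {E : Type*} [NormedAddCommGroup E] [InnerProductSpace ℝ E]
    {N : ℕ} {Li : Fin N → E → ℝ} {g : Fin N → E} {x : E}
    (h : ∀ i, HasGradAt (Li i) (g i) x) :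
    HasGradAt (avgFn N Li) ((N : ℝ)⁻¹ • ∑ i, g i) x := by
  have h_sum : HasFDerivAt (fun ν => (N : ℝ)⁻¹ * ∑ i, Li i ν)
      ((N : ℝ)⁻¹ • ∑ i, innerSL ℝ (g i)) x :=
    (HasFDerivAt.fun_sum fun i _ => h i).const_mul _
  unfold HasGradAt avgFn
  convert h_sum using 1
  rw [map_smul, map_sum]

/-- The descent lemma for a function with Lipschitz gradient. -/
theorem sub_le_of_lipschitz_grad {E : Type*} [NormedAddCommGroup E] [InnerProductSpace ℝ E]
    {f : E → ℝ} {g : E → E} (hg : ∀ x, HasGradAt f (g x) x) {K : ℝ}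
    (hK : ∀ x y, ‖g x - g y‖ ≤ K * ‖x - y‖) (x v : E) :
    f (x + v) - f x ≤ inner ℝ (g x) v + K / 2 * ‖v‖ ^ 2 := by
  let φ : ℝ → ℝ := fun t => f (x + t • v) - t * inner ℝ (g x) v - K / 2 * ‖v‖ ^ 2 * t ^ 2
  have hφ (t : ℝ) : HasDerivAt φ
      (inner ℝ (g (x + t • v)) v - inner ℝ (g x) v - K * ‖v‖ ^ 2 * t) t := by
    have h_line : HasDerivAt (fun t : ℝ => x + t • v) v t := by
      simpa using ((hasDerivAt_id t).smul_const v).const_add x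
    have h_comp : HasDerivAt (fun t : ℝ => f (x + t • v)) (inner ℝ (g (x + t • v)) v) t :=
      HasFDerivAt.comp_hasDerivAt (l := f) (l' := innerSL ℝ (g (x + t • v))) t
        (hg (x + t • v)) h_line
    refine ((h_comp.sub ((hasDerivAt_id t).mul_const (inner ℝ (g x) v))).sub
      ((hasDerivAt_pow 2 t).const_mul (K / 2 * ‖v‖ ^ 2))).congr_deriv ?_
    norm_num
    ring
  have h_anti : AntitoneOn φ (Set.Icc 0 1) := by
    refine antitoneOn_of_deriv_nonpos (convex_Icc 0 1)
      (fun t _ => (hφ t).continuousAt.continuousWithinAt)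
      (fun t _ => (hφ t).differentiableAt.differentiableWithinAt) fun t ht => ?_
    rw [interior_Icc] at ht
    rw [(hφ t).deriv, ← inner_sub_left, sub_nonpos]
    calc inner ℝ (g (x + t • v) - g x) v
        ≤ ‖g (x + t • v) - g x‖ * ‖v‖ := real_inner_le_norm _ _
      _ ≤ K * ‖x + t • v - x‖ * ‖v‖ := by gcongr; exact hK _ _
      _ = K * ‖v‖ ^ 2 * t := by
          rw [add_sub_cancel_left, norm_smul, Real.norm_of_nonneg ht.1.le]
          ring
  have h_ends := h_anti (Set.left_mem_Icc.2 zero_le_one) (Set.right_mem_Icc.2 zero_le_one)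
    zero_le_one
  simp only [φ, one_smul, zero_smul, add_zero, one_mul, zero_mul, one_pow, mul_one, sub_zero,
    ne_eq, OfNat.ofNat_ne_zero, not_false_eq_true, zero_pow, mul_zero] at h_ends
  linarith

theorem norm_sum_sq_le_card_mul {ι E : Type*} [SeminormedAddCommGroup E]
    (s : Finset ι) (e : ι → E) :
    ‖∑ i ∈ s, e i‖ ^ 2 ≤ s.card * ∑ i ∈ s, ‖e i‖ ^ 2 :=
  (pow_le_pow_left₀ (norm_nonneg _) (norm_sum_le s e) 2).trans sq_sum_le_card_mul_sum_sq

/-- Young's inequality for the squared norm of a sum. -/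
theorem norm_add_sq_le_young {E : Type*} [NormedAddCommGroup E] [InnerProductSpace ℝ E]
    {c : ℝ} (hc : 0 < c) (a b : E) :
    ‖a + b‖ ^ 2 ≤ (1 + 1 / c) * ‖a‖ ^ 2 + (1 + c) * ‖b‖ ^ 2 := by
  have h_cross : 2 * (‖a‖ * ‖b‖) ≤ 1 / c * ‖a‖ ^ 2 + c * ‖b‖ ^ 2 := by
    have h_sq : 0 ≤ 1 / c * (‖a‖ - c * ‖b‖) ^ 2 := by positivity
    have h_expand : 1 / c * (‖a‖ - c * ‖b‖) ^ 2
        = 1 / c * ‖a‖ ^ 2 + c * ‖b‖ ^ 2 - 2 * (‖a‖ * ‖b‖) := by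
      field_simp
      ring
    linarith
  rw [norm_add_sq_real]
  linarith [real_inner_le_norm a b]

theorem gradient_iterate_eq {E : Type*} [AddCommGroup E] [Module ℝ E]
    {g : E → E} {γ : ℝ} {u : ℕ → E} (hu : ∀ r, u (r + 1) = u r - γ • g (u r)) (R : ℕ) :
    u R = u 0 - γ • ∑ r ∈ Finset.range R, g (u r) := by
  induction R with
  | zero => simp
  | succ R ih => rw [hu, Finset.sum_range_succ, smul_add, ← sub_sub, ← ih]

/-- the one-round descent inequality for the federated iterates
(local steps `ν_{i,r+1}ᵗ = ν_{i,r}ᵗ − γ∇Lᵢ(ν_{i,r}ᵗ)` followed by the server update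
`ν_{t+1} = ν_t − α(ν_t − (1/N)∑ᵢ ν_{i,R}ᵗ)`), with `γ̂ = αγR`, for a global objective
`L = (1/N)∑ᵢ Lᵢ` whose gradient is `L_F`-Lipschitz. -/
theorem stmt6 {E : Type*} [NormedAddCommGroup E] [InnerProductSpace ℝ E]
    (N : ℕ) (hN : 1 ≤ N) (Li : Fin N → E → ℝ) (gi : Fin N → E → E)
    (hgrad : ∀ i x, HasGradAt (Li i) (gi i x) x)
    (gL : E → E) (hgL : ∀ x, HasGradAt (avgFn N Li) (gL x) x)
    (LF : ℝ) (hLF : 0 < LF)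
    (hLip : ∀ x y, ‖gL x - gL y‖ ≤ LF * ‖x - y‖)
    (R : ℕ) (hR : 1 ≤ R) (γ α : ℝ) (hγ : 0 < γ) (hα : 0 < α)
    (γhat : ℝ) (hγhat : γhat = α * γ * (R : ℝ))
    (νt : E) (νloc : Fin N → ℕ → E)
    (hν0 : ∀ i, νloc i 0 = νt)
    (hνstep : ∀ i r, νloc i (r + 1) = νloc i r - γ • gi i (νloc i r))
    (νt1 : E) (hserver : νt1 = νt - α • (νt - (N : ℝ)⁻¹ • ∑ i, νloc i R)) :
    avgFn N Li νt1 - avgFn N Li νt ≤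
      -(γhat / 2) * (1 - ((R : ℝ) + 1) * γhat * LF / (R : ℝ)) * ‖gL νt‖ ^ 2
        + (γhat / 2) * (1 + (1 + (R : ℝ)) * γhat * LF) *
          ((1 / ((N : ℝ) * (R : ℝ))) *
            ∑ i, ∑ r ∈ Finset.range R, ‖gi i (νloc i r) - gi i νt‖ ^ 2) := by
  have hN_pos : (0 : ℝ) < N := by exact_mod_cast hN
  have hR_pos : (0 : ℝ) < R := by exact_mod_cast hR
  have hγhat_pos : 0 < γhat := by rw [hγhat]; positivity
  set D : ℝ := (1 / ((N : ℝ) * (R : ℝ))) *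
    ∑ i, ∑ r ∈ Finset.range R, ‖gi i (νloc i r) - gi i νt‖ ^ 2 with hD
  set d : E := (1 / ((N : ℝ) * (R : ℝ))) •
    ∑ i, ∑ r ∈ Finset.range R, (gi i (νloc i r) - gi i νt) with hd
  have hdD : ‖d‖ ^ 2 ≤ D := by
    have h_sum := norm_sum_sq_le_card_mul (Finset.univ ×ˢ Finset.range R)
      fun p : Fin N × ℕ => gi p.1 (νloc p.1 p.2) - gi p.1 νt
    simp only [Finset.sum_product, Finset.card_product, Finset.card_univ, Fintype.card_fin,
      Finset.card_range, Nat.cast_mul] at h_sum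
    rw [hd, norm_smul, mul_pow, Real.norm_of_nonneg (by positivity), hD]
    refine (mul_le_mul_of_nonneg_left h_sum (by positivity)).trans_eq ?_
    field_simp
  have h_step : νt1 = νt + (-γhat) • (gL νt + d) := by
    have h_mean : νt = (N : ℝ)⁻¹ • ∑ _i : Fin N, νt := by
      rw [Finset.sum_const, Finset.card_univ, Fintype.card_fin, ← Nat.cast_smul_eq_nsmul ℝ,
        inv_smul_smul₀ hN_pos.ne']
    have h_drift : νt - (N : ℝ)⁻¹ • ∑ i, νloc i R
        = ((N : ℝ)⁻¹ * γ) • ∑ i, ∑ r ∈ Finset.range R, gi i (νloc i r) := by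
      simp only [gradient_iterate_eq (hνstep _) R, hν0, Finset.sum_sub_distrib, smul_sub]
      rw [← h_mean, sub_sub_cancel, ← Finset.smul_sum, smul_smul]
    have h_dir : gL νt + d
        = (1 / ((N : ℝ) * R)) • ∑ i, ∑ r ∈ Finset.range R, gi i (νloc i r) := by
      rw [hd, (hgL νt).unique (hasGradAt_avgFn fun i => hgrad i νt)]
      simp only [Finset.sum_sub_distrib, Finset.sum_const, Finset.card_range, smul_sub,
        ← Nat.cast_smul_eq_nsmul ℝ, ← Finset.smul_sum, smul_smul]
      rw [show 1 / ((N : ℝ) * R) * R = (N : ℝ)⁻¹ by field_simp, add_sub_cancel]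
    rw [hserver, h_drift, h_dir, smul_smul, smul_smul, neg_mul, neg_smul, ← sub_eq_add_neg, hγhat]
    congr 2
    field_simp
  have h_descent := sub_le_of_lipschitz_grad hgL hLip νt ((-γhat) • (gL νt + d))
  rw [← h_step, inner_smul_right, inner_add_right, real_inner_self_eq_norm_sq, norm_smul, mul_pow,
    Real.norm_eq_abs, sq_abs] at h_descent
  have h_young := norm_add_sq_le_young hR_pos (gL νt) d
  have h_inner : -inner ℝ (gL νt) d ≤ (‖gL νt‖ ^ 2 + ‖d‖ ^ 2) / 2 := by
    have h_nonneg := sq_nonneg ‖gL νt + d‖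
    rw [norm_add_sq_real] at h_nonneg
    linarith
  calc avgFn N Li νt1 - avgFn N Li νt
      ≤ γhat * -inner ℝ (gL νt) d - γhat * ‖gL νt‖ ^ 2
          + LF / 2 * γhat ^ 2 * ‖gL νt + d‖ ^ 2 := by linarith
    _ ≤ γhat * ((‖gL νt‖ ^ 2 + ‖d‖ ^ 2) / 2) - γhat * ‖gL νt‖ ^ 2
          + LF / 2 * γhat ^ 2 *
            ((1 + 1 / (R : ℝ)) * ‖gL νt‖ ^ 2 + (1 + (R : ℝ)) * ‖d‖ ^ 2) := by gcongr
    _ = -(γhat / 2) * (1 - ((R : ℝ) + 1) * γhat * LF / (R : ℝ)) * ‖gL νt‖ ^ 2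
          + (γhat / 2) * (1 + (1 + (R : ℝ)) * γhat * LF) * ‖d‖ ^ 2 := by
        field_simp
        ring
    _ ≤ _ := by gcongr
end

section
/- Let E be a real inner product space, N ≥ 1, and let L_1, …, L_N : E → ℝ be differentiable functions, each with L_F-Lipschitz gradient (L_F > 0). Let L = (1/N)∑_{i=1}^N L_i and suppose the bounded-variance condition holds with constant δ_L: (1/N)∑_{i=1}^N ‖∇L_i(ν) − ∇L(ν)‖² ≤ δ_L² for every ν ∈ E. Let 0 < α ≤ 1, let R ≥ 1 and T ≥ 1 be integers, let γ > 0, set γ̂ = αγR, and assume γ̂ ≤ α/(√(32(R+3))·L_F). Starting from any ν_0 ∈ E, generate the iterates ν_0, ν_1, …, ν_T by: for each round t, set ν_{i,0}^t = ν_t, ν_{i,r+1}^t = ν_{i,r}^t − γ∇L_i(ν_{i,r}^t) for r = 0,…,R−1, and ν_{t+1} = ν_t − α(ν_t − (1/N)∑_{i=1}^N ν_{i,R}^t). Then (1/T)·∑_{t=0}^{T−1} ‖∇L(ν_t)‖² ≤ 4·(L(ν_0) − L(ν_T))/(γ̂·T) + 32γ̂²L_F²δ_L²/α² + 32(1+R)γ̂³L_F³δ_L²/α².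 -/
/-- Descent lemma: the quadratic upper bound for a function with Lipschitz gradient. -/
theorem HasGradAt.le_quadratic {E : Type*} [NormedAddCommGroup E] [InnerProductSpace ℝ E]
    {f : E → ℝ} {g : E → E} {K : ℝ} (hg : ∀ x, HasGradAt f (g x) x)
    (hK : ∀ x y, ‖g x - g y‖ ≤ K * ‖x - y‖) (x v : E) :
    f (x + v) ≤ f x + inner ℝ (g x) v + K / 2 * ‖v‖ ^ 2 := by
  have hderiv : ∀ t : ℝ, HasDerivAt
      (fun t : ℝ => f (x + t • v) - t * inner ℝ (g x) v - K / 2 * ‖v‖ ^ 2 * t ^ 2)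
      (inner ℝ (g (x + t • v)) v - inner ℝ (g x) v - K * ‖v‖ ^ 2 * t) t := by
    intro t
    have hline : HasDerivAt (fun t : ℝ => x + t • v) v t := by
      simpa using ((hasDerivAt_id t).smul_const v).const_add x
    have hcomp : HasDerivAt (fun t : ℝ => f (x + t • v)) (inner ℝ (g (x + t • v)) v) t := by
      have hf : HasFDerivAt f (innerSL ℝ (g (x + t • v))) (x + t • v) := hg _
      exact hf.comp_hasDerivAt t hline
    have hlin : HasDerivAt (fun t : ℝ => t * inner ℝ (g x) v) (inner ℝ (g x) v) t := by
      simpa using (hasDerivAt_id t).mul_const (inner ℝ (g x) v)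
    have hsq : HasDerivAt (fun t : ℝ => K / 2 * ‖v‖ ^ 2 * t ^ 2) (K * ‖v‖ ^ 2 * t) t := by
      refine ((hasDerivAt_pow 2 t).const_mul (K / 2 * ‖v‖ ^ 2)).congr_deriv ?_
      norm_num
      ring
    exact (hcomp.sub hlin).sub hsq
  have hanti := antitoneOn_of_deriv_nonpos (convex_Icc (0 : ℝ) 1)
    (fun t _ => (hderiv t).continuousAt.continuousWithinAt)
    (fun t _ => (hderiv t).differentiableAt.differentiableWithinAt)
    (fun t ht => by
      rw [interior_Icc] at ht
      rw [(hderiv t).deriv, ← inner_sub_left]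
      have hCS := real_inner_le_norm (g (x + t • v) - g x) v
      have hlip := hK (x + t • v) x
      rw [add_sub_cancel_left, norm_smul, Real.norm_of_nonneg ht.1.le] at hlip
      nlinarith [mul_le_mul_of_nonneg_right hlip (norm_nonneg v)])
  have h01 := hanti (Set.left_mem_Icc.2 zero_le_one) (Set.right_mem_Icc.2 zero_le_one) zero_le_one
  simp only [one_smul, zero_smul, add_zero] at h01
  linarith

/-- The gradient of an average is the average of the gradients. -/
theorem HasGradAt.eq_avg {E : Type*} [NormedAddCommGroup E] [InnerProductSpace ℝ E]
    {N : ℕ} {Li : Fin N → E → ℝ} {g : Fin N → E} {G x : E}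
    (hg : ∀ i, HasGradAt (Li i) (g i) x) (hG : HasGradAt (avgFn N Li) G x) :
    G = (N : ℝ)⁻¹ • ∑ i, g i := by
  have hsum : HasFDerivAt (avgFn N Li) ((N : ℝ)⁻¹ • ∑ i, innerSL ℝ (g i)) x :=
    (HasFDerivAt.fun_sum fun i _ => hg i).const_mul _
  have huniq := HasFDerivAt.unique hG hsum
  refine ext_inner_right ℝ fun v => ?_
  have hv := congrArg (fun φ : E →L[ℝ] ℝ => φ v) huniq
  simpa [inner_smul_left, sum_inner] using hv

/-- The average of `N` vectors is bounded in norm by the average of the bounds. -/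
theorem norm_avg_le {E : Type*} [NormedAddCommGroup E] [NormedSpace ℝ E]
    {N : ℕ} {u : Fin N → E} {b : Fin N → ℝ} (h : ∀ i, ‖u i‖ ≤ b i) :
    ‖(N : ℝ)⁻¹ • ∑ i, u i‖ ≤ (N : ℝ)⁻¹ * ∑ i, b i := by
  rw [norm_smul, Real.norm_of_nonneg (by positivity)]
  exact mul_le_mul_of_nonneg_left (norm_sum_le_of_le _ fun i _ => h i) (by positivity)

/-- After `r ≤ R` gradient steps of total length `γ R ≤ 1 / (2 K)`, the displacement differs from
`r` frozen gradient steps by a relative error of at most `2 γ K R`. -/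
theorem norm_local_drift_le {E : Type*} [NormedAddCommGroup E] [NormedSpace ℝ E]
    {g : E → E} {K γ : ℝ} (hK0 : 0 ≤ K) (hK : ∀ x y, ‖g x - g y‖ ≤ K * ‖x - y‖)
    (hγ : 0 ≤ γ) {R : ℕ} (hs : 2 * (γ * K * R) ≤ 1) {x : ℕ → E}
    (hx : ∀ r, x (r + 1) = x r - γ • g (x r)) {r : ℕ} (hr : r ≤ R) :
    ‖x 0 - x r - (γ * r) • g (x 0)‖ ≤ γ * r * (2 * (γ * K * R)) * ‖g (x 0)‖ := by
  induction r with
  | zero => simp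
  | succ r ih =>
    have ih := ih (by omega)
    have hrR : (r : ℝ) ≤ R := by exact_mod_cast (by omega : r ≤ R)
    have hdrift : ‖x r - x 0‖ ≤ 2 * γ * R * ‖g (x 0)‖ := by
      have htri : ‖x r - x 0‖ ≤ ‖x 0 - x r - (γ * r) • g (x 0)‖ + ‖(γ * r) • g (x 0)‖ := by
        rw [norm_sub_rev]
        simpa using norm_add_le (x 0 - x r - (γ * r) • g (x 0)) ((γ * r) • g (x 0))
      rw [norm_smul, Real.norm_of_nonneg (by positivity)] at htri
      have hle : γ * r * (2 * (γ * K * R)) * ‖g (x 0)‖ ≤ γ * r * 1 * ‖g (x 0)‖ := by gcongr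
      have hle' : γ * r * ‖g (x 0)‖ ≤ γ * R * ‖g (x 0)‖ := by gcongr
      linarith
    have hstep : x 0 - x (r + 1) - (γ * (r + 1 : ℕ)) • g (x 0)
        = (x 0 - x r - (γ * r) • g (x 0)) + γ • (g (x r) - g (x 0)) := by
      rw [hx, Nat.cast_succ]
      module
    rw [hstep]
    refine (norm_add_le _ _).trans ?_
    rw [norm_smul, Real.norm_of_nonneg hγ]
    have hgr : γ * ‖g (x r) - g (x 0)‖ ≤ γ * (K * (2 * γ * R * ‖g (x 0)‖)) := by
      gcongr
      exact (hK _ _).trans (by gcongr)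
    push_cast
    linarith

/-- Mean-square form of the bounded-variance condition. -/
theorem sq_avg_norm_le {E : Type*} [NormedAddCommGroup E]
    {N : ℕ} {g : Fin N → E} {G : E} {δ : ℝ} (hN : 1 ≤ N)
    (hvar : (N : ℝ)⁻¹ * ∑ i, ‖g i - G‖ ^ 2 ≤ δ ^ 2) :
    ((N : ℝ)⁻¹ * ∑ i, ‖g i‖) ^ 2 ≤ 2 * (‖G‖ ^ 2 + δ ^ 2) := by
  have hN0 : (0 : ℝ) < N := by exact_mod_cast hN
  have hCS : (∑ i, ‖g i‖) ^ 2 ≤ N * ∑ i, ‖g i‖ ^ 2 := by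
    simpa using sq_sum_le_card_mul_sum_sq (s := Finset.univ) (f := fun i => ‖g i‖)
  have hpt : ∑ i, ‖g i‖ ^ 2 ≤ ∑ i, (2 * ‖g i - G‖ ^ 2 + 2 * ‖G‖ ^ 2) := by
    refine Finset.sum_le_sum fun i _ => ?_
    have htri : ‖g i‖ ≤ ‖g i - G‖ + ‖G‖ := by simpa using norm_add_le (g i - G) G
    nlinarith [norm_nonneg (g i), sq_nonneg (‖g i - G‖ - ‖G‖)]
  rw [Finset.sum_add_distrib, ← Finset.mul_sum, Finset.sum_const, Finset.card_univ,
    Fintype.card_fin, nsmul_eq_mul] at hpt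
  rw [inv_mul_le_iff₀ hN0] at hvar
  rw [mul_pow, inv_pow, inv_mul_le_iff₀ (by positivity)]
  nlinarith

/-- One round of federated averaging decreases the global objective, up to the drift error. -/
theorem federated_round_le {E : Type*} [NormedAddCommGroup E] [InnerProductSpace ℝ E]
    {N : ℕ} (hN : 1 ≤ N) {Li : Fin N → E → ℝ} {gi : Fin N → E → E}
    (hgrad : ∀ i x, HasGradAt (Li i) (gi i x) x) {K : ℝ} (hK0 : 0 ≤ K)
    (hK : ∀ i x y, ‖gi i x - gi i y‖ ≤ K * ‖x - y‖)
    {gL : E → E} (hgL : ∀ x, HasGradAt (avgFn N Li) (gL x) x) {δ : ℝ} {x : E}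
    (hvar : (N : ℝ)⁻¹ * ∑ i, ‖gi i x - gL x‖ ^ 2 ≤ δ ^ 2)
    {α γ : ℝ} (hα0 : 0 < α) (hα1 : α ≤ 1) (hγ : 0 < γ) {R : ℕ} (hR : 1 ≤ R)
    (hs : 4 * (γ * K * R) ≤ 1) {y : Fin N → ℕ → E} (hy0 : ∀ i, y i 0 = x)
    (hy : ∀ i r, y i (r + 1) = y i r - γ • gi i (y i r)) :
    ‖gL x‖ ^ 2 ≤ 4 * (avgFn N Li x
        - avgFn N Li (x - α • (x - (N : ℝ)⁻¹ • ∑ i, y i R))) / (α * γ * R)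
      + 16 * (γ * K * R) ^ 2 * δ ^ 2 := by
  have hN0 : (0 : ℝ) < N := by exact_mod_cast hN
  have hR0 : (0 : ℝ) < R := by exact_mod_cast hR
  have hG : ∀ z, gL z = (N : ℝ)⁻¹ • ∑ i, gi i z := fun z =>
    HasGradAt.eq_avg (fun i => hgrad i z) (hgL z)
  have hKL : ∀ z w, ‖gL z - gL w‖ ≤ K * ‖z - w‖ := by
    intro z w
    have havg := norm_avg_le fun i => hK i z w
    rw [Finset.sum_sub_distrib, smul_sub, ← hG, ← hG] at havg
    refine havg.trans_eq ?_
    simp [hN0.ne']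
  set s := γ * K * R with hsdef
  have hs0 : 0 ≤ s := by positivity
  set c := α * γ * R with hc
  have hc0 : 0 < c := by positivity
  have hcK : c * K ≤ 1 := by
    have : c * K = α * s := by rw [hc, hsdef]; ring
    nlinarith
  set D := α • (x - (N : ℝ)⁻¹ • ∑ i, y i R) with hD
  have herr : ‖D - c • gL x‖ ≤ c * (2 * s) * ((N : ℝ)⁻¹ * ∑ i, ‖gi i x‖) := by
    have hloc : ∀ i, ‖x - y i R - (γ * R) • gi i x‖ ≤ γ * R * (2 * s) * ‖gi i x‖ := by
      intro i
      have h := norm_local_drift_le hK0 (hK i) hγ.le (R := R) (by linarith) (hy i) le_rfl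
      rwa [hy0] at h
    have havg := norm_avg_le hloc
    have hx : x = (N : ℝ)⁻¹ • ∑ _i : Fin N, x := by
      simp [← Nat.cast_smul_eq_nsmul ℝ, smul_smul, hN0.ne']
    have hrew : D - c • gL x
        = α • ((N : ℝ)⁻¹ • ∑ i, (x - y i R - (γ * R) • gi i x)) := by
      rw [Finset.sum_sub_distrib, Finset.sum_sub_distrib, smul_sub, smul_sub _ (∑ _i, x), ← hx,
        ← Finset.smul_sum, hD, hG x, hc]
      module
    rw [hrew, norm_smul, Real.norm_of_nonneg hα0.le]
    refine (mul_le_mul_of_nonneg_left havg hα0.le).trans_eq ?_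
    rw [← Finset.mul_sum, hc]
    ring
  have herr_sq : ‖D - c • gL x‖ ^ 2 ≤ c ^ 2 * (8 * s ^ 2 * (‖gL x‖ ^ 2 + δ ^ 2)) := by
    calc ‖D - c • gL x‖ ^ 2 ≤ (c * (2 * s) * ((N : ℝ)⁻¹ * ∑ i, ‖gi i x‖)) ^ 2 := by gcongr
      _ = (c * (2 * s)) ^ 2 * ((N : ℝ)⁻¹ * ∑ i, ‖gi i x‖) ^ 2 := by ring
      _ ≤ (c * (2 * s)) ^ 2 * (2 * (‖gL x‖ ^ 2 + δ ^ 2)) := by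
        gcongr
        exact sq_avg_norm_le hN hvar
      _ = _ := by ring
  have hdesc := HasGradAt.le_quadratic hgL hKL x (-D)
  rw [← sub_eq_add_neg, inner_neg_right, norm_neg] at hdesc
  rw [norm_sub_sq_real, inner_smul_right, norm_smul c, Real.norm_of_nonneg hc0.le,
    real_inner_comm] at herr_sq
  have hquad : c * K * ‖D‖ ^ 2 ≤ 1 * ‖D‖ ^ 2 := by gcongr
  have hsg : 16 * s ^ 2 * ‖gL x‖ ^ 2 ≤ 1 * ‖gL x‖ ^ 2 := by
    gcongr
    nlinarith
  have hmul := mul_le_mul_of_nonneg_left hdesc hc0.le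
  have hmain : c ^ 2 * ‖gL x‖ ^ 2 ≤ c * (4 * (avgFn N Li x - avgFn N Li (x - D)))
      + c ^ 2 * (16 * s ^ 2 * δ ^ 2) := by
    nlinarith [mul_le_mul_of_nonneg_left hsg (sq_nonneg c)]
  refine le_of_mul_le_mul_left (hmain.trans_eq ?_) (pow_pos hc0 2)
  field_simp

/-- explicit-constant form of part 1 of Theorem 2 (Convergence):
the average squared gradient norm of the global objective along the federated
iterates over `T` rounds is bounded by
`4(L(ν₀) − L(ν_T))/(γ̂T) + 32γ̂²L_F²δ_L²/α² + 32(1+R)γ̂³L_F³δ_L²/α²`. -/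
theorem stmt10 {E : Type*} [NormedAddCommGroup E] [InnerProductSpace ℝ E]
    (N : ℕ) (hN : 1 ≤ N) (Li : Fin N → E → ℝ) (gi : Fin N → E → E)
    (hgrad : ∀ i x, HasGradAt (Li i) (gi i x) x)
    (LF : ℝ) (hLF : 0 < LF)
    (hLip : ∀ i x y, ‖gi i x - gi i y‖ ≤ LF * ‖x - y‖)
    (gL : E → E) (hgL : ∀ x, HasGradAt (avgFn N Li) (gL x) x)
    (δL : ℝ)
    (hvar : ∀ ν : E, (N : ℝ)⁻¹ * ∑ i, ‖gi i ν - gL ν‖ ^ 2 ≤ δL ^ 2)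
    (α : ℝ) (hα0 : 0 < α) (hα1 : α ≤ 1)
    (R T : ℕ) (hR : 1 ≤ R) (hT : 1 ≤ T) (γ : ℝ) (hγ : 0 < γ)
    (γhat : ℝ) (hγhat : γhat = α * γ * (R : ℝ))
    (hγle : γhat ≤ α / (Real.sqrt (32 * ((R : ℝ) + 3)) * LF))
    (ν : ℕ → E) (νloc : ℕ → Fin N → ℕ → E)
    (hν0 : ∀ t i, νloc t i 0 = ν t)
    (hνstep : ∀ t i r, νloc t i (r + 1) = νloc t i r - γ • gi i (νloc t i r))
    (hserver : ∀ t, ν (t + 1) = ν t - α • (ν t - (N : ℝ)⁻¹ • ∑ i, νloc t i R)) :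
    (1 / (T : ℝ)) * ∑ t ∈ Finset.range T, ‖gL (ν t)‖ ^ 2 ≤
      4 * (avgFn N Li (ν 0) - avgFn N Li (ν T)) / (γhat * (T : ℝ))
        + 32 * γhat ^ 2 * LF ^ 2 * δL ^ 2 / α ^ 2
        + 32 * (1 + (R : ℝ)) * γhat ^ 3 * LF ^ 3 * δL ^ 2 / α ^ 2 := by
  have hR1 : (1 : ℝ) ≤ R := by exact_mod_cast hR
  have hT0 : (0 : ℝ) < T := by exact_mod_cast hT
  have hγhat0 : 0 < γhat := by rw [hγhat]; positivity
  have hs : 4 * (γ * LF * R) ≤ 1 := by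
    have hsqrt : 4 ≤ √(32 * ((R : ℝ) + 3)) := Real.le_sqrt_of_sq_le (by linarith)
    rw [le_div_iff₀ (by positivity), hγhat] at hγle
    have h4 : α * (γ * LF * R) * 4 ≤ α * (γ * LF * R) * √(32 * ((R : ℝ) + 3)) := by gcongr
    exact le_of_mul_le_mul_left (by linarith) hα0
  have hround : ∀ t, ‖gL (ν t)‖ ^ 2 ≤
      4 / γhat * (avgFn N Li (ν t) - avgFn N Li (ν (t + 1)))
        + 16 * (γ * LF * R) ^ 2 * δL ^ 2 := by
    intro t
    have h := federated_round_le hN hgrad hLF.le hLip hgL (hvar (ν t)) hα0 hα1 hγ hR hs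
      (hν0 t) (hνstep t)
    rw [← hserver, ← hγhat] at h
    rwa [div_mul_eq_mul_div]
  have hsum := Finset.sum_le_sum fun t (_ : t ∈ Finset.range T) => hround t
  rw [Finset.sum_add_distrib, ← Finset.mul_sum, Finset.sum_range_sub', Finset.sum_const,
    Finset.card_range, nsmul_eq_mul] at hsum
  have hlast : 0 ≤ 32 * (1 + (R : ℝ)) * γhat ^ 3 * LF ^ 3 * δL ^ 2 / α ^ 2 := by positivity
  have hmid : 32 * γhat ^ 2 * LF ^ 2 * δL ^ 2 / α ^ 2 = 32 * (γ * LF * R) ^ 2 * δL ^ 2 := by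
    rw [hγhat]
    field_simp
  have havg : (1 / (T : ℝ)) * ∑ t ∈ Finset.range T, ‖gL (ν t)‖ ^ 2 ≤
      4 * (avgFn N Li (ν 0) - avgFn N Li (ν T)) / (γhat * (T : ℝ))
        + 16 * (γ * LF * R) ^ 2 * δL ^ 2 := by
    refine (mul_le_mul_of_nonneg_left hsum (by positivity)).trans_eq ?_
    field_simp
  have hδ : 0 ≤ (γ * LF * R) ^ 2 * δL ^ 2 := by positivity
  linarith
end
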